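/- arXiv:2210.10934 — 2 statements merged into one kernel-verified Lean document; each statement's English description precedes it below -/
import Mathlib

section
/- Let A be a k-Artinian k-algebra (finitely generated projective over k). Then A* := Hom_k(A,k) is an invertible A-module if and only if for every maximal ideal m of k there exists a field K containing k/m such that the A⊗_k K-module A*⊗_k K is cyclic. -/
universe u

section AdjointDual

variable {k A : Type*} [CommRing k] [CommRing A] [Algebra k A]
variable {C : Type*} [AddCommGroup C] [Module k C] [Module A C] [IsScalarTower k A C]

/-- The adjoint action of `A` on the `k`-dual of an `A`-module: `(a • f) c = f (a • c)`. -/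
instance (priority := 100) adjSMul : SMul A (Module.Dual k C) :=
  ⟨fun a f => f.comp ((LinearMap.lsmul A C a).restrictScalars k)⟩

theorem adj_smul_apply (a : A) (f : Module.Dual k C) (x : C) :
    (a • f) x = f (a • x) := rfl

/-- The `k`-dual of an `A`-module is an `A`-module via the adjoint action. -/
instance (priority := 100) adjModule : Module A (Module.Dual k C) :=
  { smul := (· • ·)
    one_smul := fun f => by ext x; show f ((1 : A) • x) = f x; rw [one_smul]
    mul_smul := fun a b f => by
      ext x; show f ((a * b) • x) = f (b • a • x); rw [mul_smul, smul_comm]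
    smul_zero := fun a => by ext x; rfl
    smul_add := fun a f g => by ext x; rfl
    add_smul := fun a b f => by
      ext x; show f ((a + b) • x) = f (a • x) + f (b • x); rw [add_smul, map_add]
    zero_smul := fun f => by
      ext x; show f ((0 : A) • x) = 0; rw [zero_smul, map_zero] }

instance (priority := 100) adjTower : IsScalarTower k A (Module.Dual k C) :=
  ⟨fun r a f => by
    ext x; show f ((r • a) • x) = r • f (a • x); rw [smul_assoc, map_smul]⟩

end AdjointDual

/-- `M` is a finitely generated projective (equivalently, locally free of finite rank)
`k`-module of constant rank `r`. -/
def ProjOfRank (k : Type*) [CommRing k] (M : Type*) [AddCommGroup M] [Module k M]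
    (r : ℕ) : Prop :=
  Module.Finite k M ∧ Module.Projective k M ∧
    ∀ (P : Ideal k) [P.IsPrime],
      Module.finrank (Localization P.primeCompl) (LocalizedModule P.primeCompl M) = r

open scoped TensorProduct

namespace Gorenstein

open Module

theorem nontrivial_tensorProduct_of_ker_eq {k K F : Type*} [CommRing k] [Field K] [Field F]
    [Algebra k K] [Algebra k F] (m : Ideal k) [m.IsMaximal]
    (hK : RingHom.ker (algebraMap k K) = m) (hF : RingHom.ker (algebraMap k F) = m) :
    Nontrivial (K ⊗[k] F) := by
  let _ := Ideal.Quotient.field m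
  let _ : Algebra (k ⧸ m) K :=
    (Ideal.Quotient.lift m (algebraMap k K) fun a ha => by
      rwa [← hK, RingHom.mem_ker] at ha).toAlgebra
  let _ : Algebra (k ⧸ m) F :=
    (Ideal.Quotient.lift m (algebraMap k F) fun a ha => by
      rwa [← hF, RingHom.mem_ker] at ha).toAlgebra
  have : IsScalarTower k (k ⧸ m) K := .of_algebraMap_eq fun _ => rfl
  have : IsScalarTower k (k ⧸ m) F := .of_algebraMap_eq fun _ => rfl
  exact (TensorProduct.mapOfCompatibleSMul_surjective (k ⧸ m) k (k ⧸ m) K F).nontrivial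

theorem finrank_le_one_of_span_eq_top {k K F V : Type*} [CommRing k] [Field K] [Field F]
    [Algebra k K] [Algebra k F] [AddCommGroup V] [Module F V] [Module k V] [IsScalarTower k F V]
    [Module.Finite k F] [Module.Finite F V] [Nontrivial (K ⊗[k] F)]
    (y : K ⊗[k] V)
    (hy : Submodule.span K (Set.range fun γ : F => (Algebra.lsmul k k V γ).lTensor K y) = ⊤) :
    finrank F V ≤ 1 := by
  let q : K ⊗[k] F →ₗ[K] K ⊗[k] V := LinearMap.liftBaseChange K
    (LinearMap.applyₗ y ∘ₗ LinearMap.lTensorHom K ∘ₗ (Algebra.lsmul k k V).toLinearMap)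
  have hq : Function.Surjective q := by
    rw [← LinearMap.range_eq_top, eq_top_iff, ← hy, Submodule.span_le]
    rintro _ ⟨γ, rfl⟩
    exact ⟨1 ⊗ₜ γ, by simp [q]⟩
  let e : V ≃ₗ[k] (Fin (finrank F V) → F) := (finBasis F V).equivFun.restrictScalars k
  let E : K ⊗[k] V ≃ₗ[K] (Fin (finrank F V) → K ⊗[k] F) :=
    TensorProduct.AlgebraTensorModule.congr (.refl K K) e ≪≫ₗ
      TensorProduct.piRight k K K (fun _ => F)
  have h : finrank K (K ⊗[k] V) ≤ finrank K (K ⊗[k] F) :=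
    LinearMap.finrank_le_finrank_of_surjective hq
  rw [E.finrank_eq, Module.finrank_pi_fintype] at h
  have : 0 < finrank K (K ⊗[k] F) := Module.finrank_pos
  simp only [Finset.sum_const, Finset.card_univ, Fintype.card_fin, smul_eq_mul] at h
  exact Nat.le_of_mul_le_mul_right (by simpa using h) this

/-- A finitely generated projective module has a finite dual basis. -/
theorem exists_finite_dual_basis (k M : Type*) [CommRing k] [AddCommGroup M] [Module k M]
    [Module.Finite k M] [Module.Projective k M] :
    ∃ (n : ℕ) (b : Fin n → M) (f : Fin n → Dual k M), ∀ x, ∑ i, f i x • b i = x := by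
  obtain ⟨n, p, hp⟩ := Module.Finite.exists_fin' k M
  obtain ⟨s, hs⟩ := p.exists_rightInverse_of_surjective (LinearMap.range_eq_top.2 hp)
  refine ⟨n, fun i => p (Pi.single i 1), fun i => LinearMap.proj i ∘ₗ s, fun x => ?_⟩
  conv_rhs => rw [← LinearMap.id_apply (R := k) x, ← hs, LinearMap.comp_apply,
    pi_eq_sum_univ' (s x), map_sum]
  simp

section CyclicModules

variable {R M : Type*} [CommRing R] [AddCommGroup M] [Module R M]

/-- A cyclic faithful module becomes free of rank one after localization; it suffices that some
element of the multiplicative set multiplies the module into the cyclic submodule. -/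
theorem nonempty_linearEquiv_localizedModule (S : Submonoid R)
    (hM : ∀ a : R, (∀ y : M, a • y = 0) → a = 0) (x : M) {s : R} (hs : s ∈ S)
    (hx : ∀ y : M, s • y ∈ Submodule.span R {x}) :
    Nonempty (Localization S ≃ₗ[Localization S] LocalizedModule S M) := by
  refine ⟨LinearEquiv.ofBijective
    (LinearMap.toSpanSingleton (Localization S) _ (LocalizedModule.mk x 1)) ⟨?_, ?_⟩⟩
  · rw [injective_iff_map_eq_zero]
    intro z hz
    induction z using Localization.induction_on with
    | H y =>
      obtain ⟨a, t⟩ := y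
      rw [LinearMap.toSpanSingleton_apply, LocalizedModule.mk_smul_mk,
        ← LocalizedModule.zero_mk 1, LocalizedModule.mk_eq] at hz
      obtain ⟨u, hu⟩ := hz
      simp only [smul_zero, one_smul, Submonoid.smul_def] at hu
      rw [Localization.mk_eq_mk', IsLocalization.mk'_eq_zero_iff]
      refine ⟨u * ⟨s, hs⟩, hM _ fun y => ?_⟩
      obtain ⟨c, hc⟩ := Submodule.mem_span_singleton.1 (hx y)
      calc ((u : R) * s * a) • y = (u : R) • a • s • y := by simp only [smul_smul]; ring_nf
        _ = c • (u : R) • a • x := by rw [← hc]; simp only [smul_smul]; ring_nf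
        _ = 0 := by rw [hu, smul_zero]
  · intro z
    induction z using LocalizedModule.induction_on with
    | h y t =>
      obtain ⟨a, ha⟩ := Submodule.mem_span_singleton.1 (hx y)
      refine ⟨Localization.mk a (⟨s, hs⟩ * t), ?_⟩
      rw [LinearMap.toSpanSingleton_apply, LocalizedModule.mk_smul_mk, ha, mul_one]
      exact LocalizedModule.mk_cancel_common_left ⟨s, hs⟩ t y

theorem exists_notMem_smul_mem_span [Module.Finite R M] (I : Ideal R) [I.IsMaximal]
    (h : letI := Ideal.Quotient.field I
      finrank (R ⧸ I) (M ⧸ (I • ⊤ : Submodule R M)) ≤ 1) :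
    ∃ x : M, ∃ s ∉ I, ∀ y : M, s • y ∈ Submodule.span R {x} := by
  let _ := Ideal.Quotient.field I
  obtain ⟨v, hv⟩ := finrank_le_one_iff.1 h
  obtain ⟨x, rfl⟩ := Submodule.Quotient.mk_surjective _ v
  refine ⟨x, ?_⟩
  set N := Submodule.span R {x}
  have key : (⊤ : Submodule R (M ⧸ N)) ≤ I • ⊤ := by
    rintro z -
    obtain ⟨y, rfl⟩ := Submodule.Quotient.mk_surjective _ z
    obtain ⟨c, hc⟩ := hv (Submodule.Quotient.mk y)
    obtain ⟨a, rfl⟩ := Ideal.Quotient.mk_surjective c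
    have hy : y - a • x ∈ (I • ⊤ : Submodule R M) := by
      rw [← Submodule.Quotient.mk_eq_zero, Submodule.Quotient.mk_sub, ← hc, sub_eq_zero]
      rfl
    have hmem := Submodule.mem_map_of_mem (f := N.mkQ) hy
    rw [Submodule.map_smul''] at hmem
    have hx0 : N.mkQ (a • x) = 0 := by
      rw [Submodule.mkQ_apply, Submodule.Quotient.mk_eq_zero]
      exact N.smul_mem _ (Submodule.mem_span_singleton_self x)
    rw [map_sub, hx0, sub_zero] at hmem
    exact Submodule.smul_mono le_rfl le_top hmem
  obtain ⟨r, hr, hr0⟩ := Submodule.exists_sub_one_mem_and_smul_eq_zero_of_fg_of_le_smul I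
    (⊤ : Submodule R (M ⧸ N)) Module.Finite.fg_top key
  refine ⟨r, fun hrI => ?_, fun y => ?_⟩
  · exact (Ideal.ne_top_iff_one I).1 (Ideal.IsMaximal.ne_top ‹_›)
      (by simpa using I.sub_mem hrI hr)
  · have := hr0 (Submodule.Quotient.mk y) trivial
    rwa [← Submodule.Quotient.mk_smul, Submodule.Quotient.mk_eq_zero] at this

theorem projOfRank_one_of_forall_isMaximal [IsNoetherianRing R] [Module.Finite R M]
    (hM : ∀ a : R, (∀ y : M, a • y = 0) → a = 0)
    (h : ∀ I : Ideal R, I.IsMaximal → ∃ x : M, ∃ s ∉ I, ∀ y : M, s • y ∈ Submodule.span R {x}) :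
    ProjOfRank R M 1 := by
  have key (P : Ideal R) [P.IsPrime] : Nonempty
      (Localization P.primeCompl ≃ₗ[Localization P.primeCompl] LocalizedModule P.primeCompl M) := by
    obtain ⟨I, hI, hPI⟩ := P.exists_le_maximal (Ideal.IsPrime.ne_top ‹_›)
    obtain ⟨x, s, hs, hx⟩ := h I hI
    exact nonempty_linearEquiv_localizedModule _ hM x
      (show s ∈ P.primeCompl from fun h => hs (hPI h)) hx
  refine ⟨‹_›, ?_, fun P _ => ?_⟩
  · have := Module.finitePresentation_of_finite R M
    refine Module.projective_of_localization_maximal fun I hI => ?_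
    obtain ⟨e⟩ := key I
    exact .of_equiv e
  · obtain ⟨e⟩ := key P
    rw [← e.finrank_eq, finrank_self]

theorem _root_.ProjOfRank.exists_sub_smul_mem_smul_top (h : ProjOfRank R M 1) (J : Ideal R)
    [Finite (MaximalSpectrum (R ⧸ J))] :
    ∃ x : M, ∀ y : M, ∃ a : R, y - a • x ∈ (J • ⊤ : Submodule R M) := by
  obtain ⟨_, _, hr⟩ := h
  have : Nonempty (Basis (Fin 1) (R ⧸ J) ((R ⧸ J) ⊗[R] M)) := by
    refine nonempty_basis_of_flat_of_finrank_eq _ _ 1 fun P => ?_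
    let _ := Ideal.Quotient.field P.1
    have := congr_fun (rankAtStalk_eq_finrank_of_free (R := (R ⧸ J) ⧸ P.1)
      (M := ((R ⧸ J) ⧸ P.1) ⊗[R ⧸ J] ((R ⧸ J) ⊗[R] M))) ⊥
    rw [rankAtStalk_baseChange, rankAtStalk_baseChange] at this
    exact (this.symm.trans (hr _) :)
  obtain ⟨b⟩ := this
  let e := TensorProduct.quotTensorEquivQuotSMul M J
  obtain ⟨x, hx⟩ := Submodule.Quotient.mk_surjective _ (e (b 0))
  refine ⟨x, fun y => ?_⟩
  obtain ⟨a, ha⟩ := Ideal.Quotient.mk_surjective (b.repr (1 ⊗ₜ y) 0)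
  refine ⟨a, ?_⟩
  have h1 : (1 : R ⧸ J) ⊗ₜ[R] y = a • b 0 := by
    rw [← b.sum_repr (1 ⊗ₜ y), Fin.sum_univ_one, ← ha]
    exact (algebraMap_smul (R ⧸ J) a (b 0) :)
  rw [← Submodule.Quotient.mk_eq_zero, Submodule.Quotient.mk_sub, Submodule.Quotient.mk_smul, hx,
    ← map_smul, ← h1, TensorProduct.quotTensorEquivQuotSMul_mk_one_tmul, sub_self]

end CyclicModules

section Dual

variable {k A : Type*} [CommRing k] [CommRing A] [Algebra k A]

theorem apply_mem_of_mem_map_smul_top (m : Ideal k) {f : Dual k A}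
    (hf : f ∈ (m.map (algebraMap k A) • ⊤ : Submodule A (Dual k A))) (b : A) : f b ∈ m := by
  induction hf using Submodule.smul_induction_on' with
  | smul a ha g _ =>
    rw [adj_smul_apply, smul_eq_mul]
    induction ha using Submodule.span_induction generalizing b with
    | mem a ha =>
      obtain ⟨c, hc, rfl⟩ := ha
      rw [← Algebra.smul_def, map_smul]
      exact m.mul_mem_right _ hc
    | zero => simp
    | add a a' _ _ h h' =>
      rw [add_mul, map_add]
      exact m.add_mem (h b) (h' b)
    | smul r a _ h =>
      rw [smul_eq_mul, mul_assoc, mul_left_comm]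
      exact h _
  | add f _ g _ h h' => exact m.add_mem h h'

theorem eq_zero_of_forall_smul_dual_eq_zero [Module.Projective k A] (a : A)
    (h : ∀ f : Dual k A, a • f = 0) : a = 0 := by
  rw [← forall_dual_apply_eq_zero_iff k]
  intro f
  simpa [adj_smul_apply] using LinearMap.congr_fun (h f) 1

/-- If `k → K` is surjective with kernel `m` and `x` generates the dual of `A` modulo `m`, then the
base change of `x` generates the dual of `K ⊗ A`. -/
theorem span_baseChange_eq_top [Module.Projective k A] {K : Type*} [Field K] [Algebra k K]
    (hK : Function.Surjective (algebraMap k K)) (x : Dual k A)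
    (hx : ∀ f : Dual k A, ∃ a : A, f - a • x ∈
      ((RingHom.ker (algebraMap k K)).map (algebraMap k A) • ⊤ : Submodule A (Dual k A))) :
    Submodule.span (K ⊗[k] A) {x.baseChange K} = (⊤ : Submodule _ (Dual K (K ⊗[k] A))) := by
  rw [eq_top_iff]
  rintro g -
  obtain ⟨f, hf⟩ := projective_lifting_property (Algebra.linearMap k K)
    (g.restrictScalars k ∘ₗ TensorProduct.mk k K A 1) hK
  obtain ⟨a, ha⟩ := hx f
  refine Submodule.mem_span_singleton.2 ⟨1 ⊗ₜ a, ?_⟩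
  ext b
  have h1 := apply_mem_of_mem_map_smul_top _ ha b
  rw [RingHom.mem_ker, LinearMap.sub_apply, map_sub, sub_eq_zero] at h1
  have h2 := LinearMap.congr_fun hf b
  simp only [LinearMap.comp_apply, Algebra.linearMap_apply, LinearMap.restrictScalars_apply,
    TensorProduct.mk_apply] at h2
  simp only [TensorProduct.AlgebraTensorModule.curry_apply, LinearMap.restrictScalars_apply,
    TensorProduct.curry_apply]
  rw [← h2, h1, adj_smul_apply, adj_smul_apply, smul_eq_mul, Algebra.TensorProduct.tmul_mul_tmul,
    Module.Dual.baseChange_apply_tmul, Algebra.smul_def, mul_one, mul_one, smul_eq_mul]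

set_option maxHeartbeats 400000 in
theorem finrank_dual_quotient_le_one [Module.Finite k A] [Module.Projective k A]
    (I : Ideal A) [I.IsMaximal] {K : Type*} [Field K] [Algebra k K]
    (hK : RingHom.ker (algebraMap k K) = I.comap (algebraMap k A)) (x : Dual K (K ⊗[k] A))
    (hx : Submodule.span (K ⊗[k] A) {x} = ⊤) :
    letI := Ideal.Quotient.field I
    finrank (A ⧸ I) (Dual k A ⧸ (I • ⊤ : Submodule A (Dual k A))) ≤ 1 := by
  let _ := Ideal.Quotient.field I
  set V := Dual k A ⧸ (I • ⊤ : Submodule A (Dual k A))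
  obtain ⟨n, b, f, hbf⟩ := exists_finite_dual_basis k A
  have hf (φ : Dual k A) : ∑ i, φ (b i) • f i = φ := by
    ext a
    conv_rhs => rw [← hbf a, map_sum]
    simp [mul_comm]
  have : Module.Finite A (Dual k A) := .of_restrictScalars_finite k A _
  have : IsScalarTower k (A ⧸ I) V := by
    refine ⟨fun r γ v => ?_⟩
    obtain ⟨a, rfl⟩ := Ideal.Quotient.mk_surjective γ
    exact smul_assoc r a v
  have : Module.Finite (A ⧸ I) V := .of_restrictScalars_finite A _ _
  have : (I.comap (algebraMap k A)).IsMaximal :=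
    Ideal.isMaximal_comap_of_isIntegral_of_isMaximal I
  have : Nontrivial (K ⊗[k] (A ⧸ I)) :=
    nontrivial_tensorProduct_of_ker_eq _ hK (by
      ext a
      exact Ideal.Quotient.eq_zero_iff_mem)
  let π : Dual k A →ₗ[k] V := (Submodule.mkQ _).restrictScalars k
  let Ψ : Dual K (K ⊗[k] A) →ₗ[K] K ⊗[k] V :=
    ∑ i, (LinearMap.toSpanSingleton K (K ⊗[k] V) (1 ⊗ₜ π (f i))) ∘ₗ
      LinearMap.applyₗ (1 ⊗ₜ b i)
  have hΨ (g) : Ψ g = ∑ i, g (1 ⊗ₜ b i) ⊗ₜ π (f i) := by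
    simp [Ψ, TensorProduct.smul_tmul']
  refine finrank_le_one_of_span_eq_top (Ψ x) <| eq_top_iff.2 fun w _ => ?_
  have hΨ_surj : Function.Surjective Ψ := by
    intro w
    induction w using TensorProduct.induction_on with
    | zero => exact ⟨0, map_zero _⟩
    | add w w' h h' =>
      obtain ⟨g, rfl⟩ := h
      obtain ⟨g', rfl⟩ := h'
      exact ⟨g + g', map_add ..⟩
    | tmul c v =>
      obtain ⟨φ, rfl⟩ := Submodule.mkQ_surjective _ v
      refine ⟨c • φ.baseChange K, ?_⟩
      rw [map_smul, hΨ]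
      simp only [Module.Dual.baseChange_apply_tmul, TensorProduct.smul_tmul, ← map_smul]
      rw [← TensorProduct.tmul_sum, ← map_sum, hf, TensorProduct.smul_tmul', smul_eq_mul, mul_one]
      rfl
  have hΨ_smul (c : K) (a : A) (g) : Ψ ((c ⊗ₜ[k] a) • g) =
      c • (Algebra.lsmul k k V (Ideal.Quotient.mk I a)).lTensor K (Ψ g) := by
    have h1 (i) : ((c ⊗ₜ[k] a) • g) (1 ⊗ₜ b i) =
        c • ∑ j, f j (a * b i) • g (1 ⊗ₜ b j) := by
      rw [adj_smul_apply, smul_eq_mul, Algebra.TensorProduct.tmul_mul_tmul, mul_one]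
      conv_lhs => rw [← hbf (a * b i), ← mul_one c, ← smul_eq_mul, ← TensorProduct.smul_tmul',
        map_smul, TensorProduct.tmul_sum, map_sum]
      simp only [TensorProduct.tmul_smul, LinearMap.map_smul_of_tower]
    have h2 (j) : Ideal.Quotient.mk I a • π (f j) = ∑ i, f j (a * b i) • π (f i) := by
      simp only [← map_smul, ← map_sum]
      have := hf (a • f j)
      simp only [adj_smul_apply, smul_eq_mul] at this
      rw [this]
      rfl
    rw [hΨ, hΨ, map_sum]
    simp only [h1, LinearMap.lTensor_tmul, Algebra.lsmul_coe, h2,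
      TensorProduct.tmul_sum, TensorProduct.sum_tmul, ← TensorProduct.smul_tmul',
      TensorProduct.tmul_smul, ← Finset.smul_sum]
    rw [Finset.sum_comm]
  obtain ⟨g, rfl⟩ := hΨ_surj w
  obtain ⟨r, rfl⟩ := Submodule.mem_span_singleton.1 (hx ▸ Submodule.mem_top : g ∈ _)
  induction r using TensorProduct.induction_on with
  | zero => rw [zero_smul, map_zero]; exact Submodule.zero_mem _
  | add r r' h h' => rw [add_smul, map_add]; exact Submodule.add_mem _ (h trivial) (h' trivial)
  | tmul c a =>
    rw [hΨ_smul]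
    exact Submodule.smul_mem _ _ (Submodule.subset_span ⟨_, rfl⟩)

end Dual

end Gorenstein

/-- Let `A` be a `k`-Artinian `k`-algebra (finitely generated projective over `k`).
Then `A* = Hom_k(A,k)` (with the adjoint `A`-action) is an invertible `A`-module
(i.e. `A` is `k`-Gorenstein) if and only if for every maximal ideal `m` of `k` there
is a field `K` containing `k/m` such that the `A ⊗_k K`-module `A* ⊗_k K ≅ (A ⊗_k K)*`
is cyclic. -/
theorem gorenstein_iff_dual_cyclic_over_fields
    (k A : Type u) [CommRing k] [IsNoetherianRing k] [CommRing A] [Algebra k A]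
    [Module.Finite k A] [Module.Projective k A] :
    ProjOfRank A (Module.Dual k A) 1 ↔
      ∀ m : Ideal k, m.IsMaximal →
        ∃ (K : Type u) (_ : Field K) (_ : Algebra k K),
          RingHom.ker (algebraMap k K) = m ∧
          ∃ x : Module.Dual K (K ⊗[k] A),
            Submodule.span (K ⊗[k] A) {x} = ⊤ := by
  constructor
  · intro h m hm
    let _ := Ideal.Quotient.field m
    let J := m.map (algebraMap k A)
    have : Module.Finite (k ⧸ m) (A ⧸ J) := .of_restrictScalars_finite k _ _
    have : IsArtinianRing (A ⧸ J) := .of_finite (k ⧸ m) _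
    obtain ⟨x, hx⟩ := h.exists_sub_smul_mem_smul_top J
    have hker : RingHom.ker (algebraMap k (k ⧸ m)) = m := Ideal.mk_ker
    exact ⟨k ⧸ m, inferInstance, inferInstance, hker, x.baseChange (k ⧸ m),
      Gorenstein.span_baseChange_eq_top Ideal.Quotient.mk_surjective x (by rwa [hker])⟩
  · intro h
    have : IsNoetherianRing A := .of_finite k A
    have : Module.Finite A (Module.Dual k A) := .of_restrictScalars_finite k A _
    refine Gorenstein.projOfRank_one_of_forall_isMaximal
      Gorenstein.eq_zero_of_forall_smul_dual_eq_zero fun I hI => ?_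
    obtain ⟨K, _, _, hK, x, hx⟩ := h (I.comap (algebraMap k A))
      (Ideal.isMaximal_comap_of_isIntegral_of_isMaximal I)
    exact Gorenstein.exists_notMem_smul_mem_span I
      (Gorenstein.finrank_dual_quotient_le_one I hK x hx)
end

section
/- Let k be a field, M = ⊕_p M_p a finitely generated graded module over a graded k-algebra A, and g_1, …, g_m nonzero homogeneous elements of A of positive degrees d_1, …, d_m. Set M^(m) := M / Σ_i g_i M and P(z) := Π_{i=1}^m (1 − z^{d_i}). Then the Hilbert series satisfy H(M, z) ≤ H(M^(m), z) / P(z) coefficientwise; and for an integer n, equality of the coefficients in degrees < n holds if and only if for each 1 ≤ q ≤ m and each p < n the multiplication map g_q : (M^(q−1))_{p−d_q} → (M^(q−1))_p is injective, where M^(q) := M / Σ_{i≤q} g_i M. -/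
/-- The submodule `g_1 M + ⋯ + g_q M` of `M`. -/
def subGen {A M : Type*} [CommRing A] [AddCommGroup M] [Module A M]
    {m : ℕ} (g : Fin m → A) (q : ℕ) : Submodule A M :=
  ⨆ (i : Fin m) (_ : (i : ℕ) < q), LinearMap.range (LinearMap.lsmul A M (g i))

/-- The coefficient of `z^j` in `1/P(z) = ∏_{i} (1 - z^{d_i})⁻¹`: the number of ways of
writing `j = ∑ c_i d_i` with `c_i ∈ ℕ`. -/
noncomputable def invPCoeff {m : ℕ} (d : Fin m → ℕ) (j : ℤ) : ℕ :=
  Set.ncard {c : Fin m → ℕ | (∑ i, (c i : ℤ) * (d i : ℤ)) = j}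

/-- The degree-`p` graded piece of `M/(g_1 M + ⋯ + g_q M)` (the image of `M_p`). -/
def quotPiece {k A M : Type*} [CommRing k] [CommRing A] [Algebra k A]
    [AddCommGroup M] [Module k M] [Module A M] [IsScalarTower k A M]
    (ℳ : ℤ → Submodule k M) {m : ℕ} (g : Fin m → A) (q : ℕ) (p : ℤ) :
    Submodule k (M ⧸ subGen (M := M) g q) :=
  (ℳ p).map ((subGen (M := M) g q).mkQ.restrictScalars k)

section PowerSeriesAux

open PowerSeries Finset

/-- The geometric series `1 / (1 - X ^ d)` for `d > 0`. -/
noncomputable def geomSeries (d : ℕ) : ℤ⟦X⟧ :=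
  PowerSeries.mk fun t => if d ∣ t then 1 else 0

lemma one_sub_X_pow_mul_geomSeries {d : ℕ} (hd : 0 < d) : (1 - X ^ d) * geomSeries d = 1 := by
  ext t
  rw [sub_mul, one_mul, map_sub, coeff_X_pow_mul', coeff_one]
  simp only [geomSeries, coeff_mk]
  by_cases h : d ≤ t
  · have ht : t ≠ 0 := by omega
    simp [h, ht, Nat.dvd_sub_iff_left h dvd_rfl]
  · rw [if_neg h, sub_zero]
    refine if_congr ⟨fun h' => ?_, fun h' => h' ▸ dvd_zero d⟩ rfl rfl
    by_contra h0
    exact h (Nat.le_of_dvd (Nat.pos_of_ne_zero h0) h')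

lemma coeff_mul_nonneg {f g : ℤ⟦X⟧} (hf : ∀ t, 0 ≤ coeff t f) (hg : ∀ t, 0 ≤ coeff t g)
    (t : ℕ) : 0 ≤ coeff t (f * g) := by
  rw [coeff_mul]
  exact sum_nonneg fun x _ => mul_nonneg (hf _) (hg _)

lemma coeff_geomSeries_nonneg (d t : ℕ) : 0 ≤ coeff t (geomSeries d) := by
  simp only [geomSeries, coeff_mk]
  split_ifs <;> simp

lemma coeff_prod_geomSeries_nonneg {m : ℕ} (d : Fin m → ℕ) (t : ℕ) :
    0 ≤ coeff t (∏ i, geomSeries (d i)) := by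
  induction m generalizing t with
  | zero =>
    simp only [univ_eq_empty, prod_empty, coeff_one]
    split_ifs <;> simp
  | succ m ih =>
    rw [Fin.prod_univ_castSucc]
    exact coeff_mul_nonneg (ih _) (coeff_geomSeries_nonneg _) t

lemma constantCoeff_geomSeries (d : ℕ) : constantCoeff (geomSeries d) = 1 := by
  rw [← coeff_zero_eq_constantCoeff_apply]
  simp [geomSeries]

/-- Unwinding the recursion `(1 - X ^ d q) * F q = F (q + 1) - K q`. -/
lemma exists_eq_mul_prod_sub_sum {m : ℕ} (d : Fin m → ℕ) (hd : ∀ i, 0 < d i)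
    (F : ℕ → ℤ⟦X⟧) (K : Fin m → ℤ⟦X⟧)
    (h : ∀ q : Fin m, (1 - X ^ d q) * F q = F (q + 1) - K q) :
    ∃ E : Fin m → ℤ⟦X⟧, (∀ q t, 0 ≤ coeff t (E q)) ∧ (∀ q, constantCoeff (E q) = 1) ∧
      F 0 = (∏ i, geomSeries (d i)) * F m - ∑ q, K q * E q := by
  induction m with
  | zero => exact ⟨fun _ => 1, fun q => q.elim0, fun q => q.elim0, by simp⟩
  | succ m ih =>
    obtain ⟨E, hE, hE1, hF⟩ := ih (fun i => d i.castSucc) (fun i => hd _)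
      (fun i => K i.castSucc) (fun q => h q.castSucc)
    refine ⟨Fin.snoc E (∏ i, geomSeries (d i)), fun q t => ?_, fun q => ?_, ?_⟩
    · induction q using Fin.lastCases with
      | last => simpa using coeff_prod_geomSeries_nonneg d t
      | cast q => simpa using hE q t
    · induction q using Fin.lastCases with
      | last => simp [map_prod, constantCoeff_geomSeries]
      | cast q => simpa using hE1 q
    · have h1 := h (Fin.last m)
      have h2 := one_sub_X_pow_mul_geomSeries (hd (Fin.last m))
      simp only [Fin.val_last] at h1
      rw [hF, Fin.sum_univ_castSucc, Fin.prod_univ_castSucc]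
      simp only [Fin.snoc_castSucc, Fin.snoc_last]
      linear_combination (∏ i : Fin m, geomSeries (d i.castSucc)) * geomSeries (d (Fin.last m)) * h1
        - (∏ i : Fin m, geomSeries (d i.castSucc)) * F m * h2

/-- If `K q` and `E q` have nonnegative coefficients and `E q` has constant term `1`, then
`∑ K q * E q` vanishes in low degrees iff all the `K q` do. -/
lemma forall_coeff_sum_mul_eq_zero_iff {ι : Type*} [Fintype ι] (K E : ι → ℤ⟦X⟧)
    (hK : ∀ q t, 0 ≤ coeff t (K q)) (hE : ∀ q t, 0 ≤ coeff t (E q))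
    (hE1 : ∀ q, constantCoeff (E q) = 1) (N : ℕ) :
    (∀ t < N, coeff t (∑ q, K q * E q) = 0) ↔ ∀ q, ∀ t < N, coeff t (K q) = 0 := by
  constructor
  · intro h q t ht
    have h1 := h t ht
    rw [map_sum, sum_eq_zero_iff_of_nonneg
      (fun q _ => coeff_mul_nonneg (hK q) (hE q) t)] at h1
    have h2 := h1 q (mem_univ q)
    rw [coeff_mul, sum_eq_zero_iff_of_nonneg
      (fun x _ => mul_nonneg (hK q _) (hE q _))] at h2
    simpa [hE1 q] using h2 (t, 0) (by simp)
  · intro h t ht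
    rw [map_sum]
    refine sum_eq_zero fun q _ => ?_
    rw [coeff_mul]
    refine sum_eq_zero fun x hx => ?_
    have := mem_antidiagonal.1 hx
    rw [h q x.1 (by omega), zero_mul]

lemma coeff_prod_geomSeries {m : ℕ} (d : Fin m → ℕ) (hd : ∀ i, 0 < d i) (t : ℕ) :
    coeff t (∏ i, geomSeries (d i)) = invPCoeff d t := by
  classical
  rw [coeff_prod]
  simp only [geomSeries, coeff_mk]
  have h1 : ∀ l : Fin m →₀ ℕ, (∏ i, if d i ∣ l i then (1 : ℤ) else 0) =
      if ∀ i, d i ∣ l i then 1 else 0 := fun l => by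
    simp [Finset.prod_ite_zero]
  simp only [h1, sum_boole]
  norm_cast
  rw [invPCoeff, ← Set.ncard_coe_finset]
  symm
  refine Set.ncard_congr (fun c _ => Finsupp.equivFunOnFinite.symm fun i => c i * d i)
    (fun c hc => ?_) (fun c c' _ _ h => ?_) (fun l hl => ?_)
  · have hc' : ∑ i, c i * d i = t := by
      have : (∑ i, (c i : ℤ) * (d i : ℤ)) = t := hc
      exact_mod_cast this
    simp [mem_finsuppAntidiag, hc']
  · ext i
    have := DFunLike.congr_fun h i
    simp only [Finsupp.equivFunOnFinite_symm_apply_apply] at this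
    exact Nat.eq_of_mul_eq_mul_right (hd i) this
  · simp only [coe_filter, Set.mem_ofPred_eq, mem_finsuppAntidiag] at hl
    refine ⟨fun i => l i / d i, ?_, ?_⟩
    · have : ∑ i, l i / d i * d i = t := by
        rw [← hl.1.1]
        exact sum_congr rfl fun i _ => Nat.div_mul_cancel (hl.2 i)
      change (∑ i, ((l i / d i : ℕ) : ℤ) * (d i : ℤ)) = t
      exact_mod_cast this
    · ext i
      simpa using Nat.div_mul_cancel (hl.2 i)

end PowerSeriesAux

lemma invPCoeff_of_neg {m : ℕ} (d : Fin m → ℕ) {j : ℤ} (hj : j < 0) : invPCoeff d j = 0 := by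
  refine (congrArg Set.ncard (Set.eq_empty_of_forall_notMem fun c hc => ?_)).trans (Set.ncard_empty _)
  have h1 : (∑ i, (c i : ℤ) * (d i : ℤ)) = j := hc
  have h2 : 0 ≤ ∑ i, (c i : ℤ) * (d i : ℤ) := by positivity
  omega

lemma finsum_mul_invPCoeff_of_lt {m : ℕ} (d : Fin m → ℕ) (f : ℤ → ℕ) {b p : ℤ}
    (hf : ∀ p < b, f p = 0) (hp : p < b) : ∑ᶠ j : ℤ, f (p - j) * invPCoeff d j = 0 := by
  refine finsum_eq_zero_of_forall_eq_zero fun j => ?_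
  rcases lt_or_ge j 0 with hj | hj
  · rw [invPCoeff_of_neg d hj, mul_zero]
  · rw [hf _ (by omega), zero_mul]

/-- The convolution in the statement is a coefficient of a product of power series. -/
lemma finsum_mul_invPCoeff {m : ℕ} (d : Fin m → ℕ) (hd : ∀ i, 0 < d i) (f : ℤ → ℕ) {b : ℤ}
    (hf : ∀ p < b, f p = 0) (t : ℕ) :
    ((∑ᶠ j : ℤ, f (b + t - j) * invPCoeff d j : ℕ) : ℤ) =
      PowerSeries.coeff t ((∏ i, geomSeries (d i)) *
        PowerSeries.mk fun s => (f (b + s) : ℤ)) := by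
  rw [PowerSeries.coeff_mul, finsum_eq_sum_of_support_subset
    (s := (Finset.range (t + 1)).map Nat.castEmbedding), Finset.sum_map,
    Finset.Nat.sum_antidiagonal_eq_sum_range_succ_mk, Nat.cast_sum]
  · refine Finset.sum_congr rfl fun j hj => ?_
    have hj' : j ≤ t := by simpa [Nat.lt_succ_iff] using hj
    rw [coeff_prod_geomSeries d hd, PowerSeries.coeff_mk, Nat.cast_sub hj', mul_comm]
    simp [add_sub_assoc]
  · intro j hj
    rw [Function.mem_support] at hj
    have h0 : 0 ≤ j := by
      by_contra h
      exact hj (by rw [invPCoeff_of_neg d (by omega), mul_zero])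
    have h1 : j ≤ t := by
      by_contra h
      exact hj (by rw [hf _ (by omega), zero_mul])
    simp only [Finset.coe_map, Set.mem_image, Finset.mem_coe, Finset.mem_range]
    exact ⟨j.toNat, by omega, by simp [h0]⟩

section Graded

open DirectSum

variable {k A M : Type*} [Field k] [CommRing A] [Algebra k A]
    [AddCommGroup M] [Module k M] [Module A M]

lemma decompose_smul_apply (𝒜 : ℤ → Submodule k A)
    (ℳ : ℤ → Submodule k M) [DirectSum.Decomposition ℳ] [SetLike.GradedSMul 𝒜 ℳ]
    {a : A} {i : ℤ} (ha : a ∈ 𝒜 i) (x : M) (p : ℤ) :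
    (decompose ℳ (a • x) p : M) = a • (decompose ℳ x (p - i) : M) := by
  induction x using DirectSum.Decomposition.inductionOn ℳ with
  | zero => simp
  | @homogeneous j y =>
    have hy : a • (y : M) ∈ ℳ (i + j) := SetLike.GradedSMul.smul_mem ha y.2
    by_cases h : p = i + j
    · subst h
      rw [decompose_of_mem_same ℳ hy, add_sub_cancel_left, decompose_of_mem_same ℳ y.2]
    · rw [decompose_of_mem_ne ℳ hy (Ne.symm h), decompose_of_mem_ne ℳ y.2 (by omega), smul_zero]
  | add x y hx hy => simp [decompose_add, smul_add, hx, hy]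

/-- The elements of `M` whose homogeneous components of degree `< b` vanish. -/
def degreeGE (𝒜 : ℤ → Submodule k A) [GradedAlgebra 𝒜] (h𝒜neg : ∀ p : ℤ, p < 0 → 𝒜 p = ⊥)
    (ℳ : ℤ → Submodule k M) [DirectSum.Decomposition ℳ] [SetLike.GradedSMul 𝒜 ℳ]
    (b : ℤ) : Submodule A M where
  carrier := {x | ∀ p < b, (decompose ℳ x p : M) = 0}
  zero_mem' p _ := by simp
  add_mem' {x y} hx hy p hp := by simp [decompose_add, hx p hp, hy p hp]
  smul_mem' a x hx := by
    induction a using DirectSum.Decomposition.inductionOn 𝒜 with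
    | zero => simp
    | @homogeneous i a =>
      intro p hp
      rw [decompose_smul_apply 𝒜 ℳ a.2]
      rcases lt_or_ge i 0 with hi | hi
      · have ha : (a : A) = 0 := by simpa [h𝒜neg i hi] using a.2
        rw [ha, zero_smul]
      · rw [hx _ (by omega), smul_zero]
    | add a a' ha ha' =>
      intro p hp
      simp [add_smul, decompose_add, ha p hp, ha' p hp]

/-- A finitely generated graded module over a nonnegatively graded algebra is bounded below. -/
lemma exists_forall_lt_eq_bot (𝒜 : ℤ → Submodule k A) [GradedAlgebra 𝒜]
    (h𝒜neg : ∀ p : ℤ, p < 0 → 𝒜 p = ⊥)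
    (ℳ : ℤ → Submodule k M) [DirectSum.Decomposition ℳ] [SetLike.GradedSMul 𝒜 ℳ]
    [Module.Finite A M] : ∃ b : ℤ, ∀ p < b, ℳ p = ⊥ := by
  classical
  obtain ⟨S, hS⟩ := Module.Finite.fg_top (R := A) (M := M)
  obtain ⟨b, hb⟩ := (S.biUnion fun x => (decompose ℳ x).support).bddBelow
  have h : Submodule.span A (S : Set M) ≤ degreeGE 𝒜 h𝒜neg ℳ b := by
    refine Submodule.span_le.2 fun x hx p hp => ?_
    by_contra h0
    have : p ∈ S.biUnion fun x => (decompose ℳ x).support :=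
      Finset.mem_biUnion.2 ⟨x, hx, DFinsupp.mem_support_iff.2 fun h => h0 (by rw [h]; rfl)⟩
    exact absurd (hb this) (not_le.2 hp)
  refine ⟨b, fun p hp => (Submodule.eq_bot_iff _).2 fun x hx => ?_⟩
  have hx' : x ∈ degreeGE 𝒜 h𝒜neg ℳ b := h (hS ▸ Submodule.mem_top)
  rw [← decompose_of_mem_same ℳ hx]
  exact hx' p hp

variable {m : ℕ}

lemma decompose_mem_subGen (𝒜 : ℤ → Submodule k A)
    (ℳ : ℤ → Submodule k M) [DirectSum.Decomposition ℳ] [SetLike.GradedSMul 𝒜 ℳ]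
    {d : Fin m → ℕ} {g : Fin m → A} (hghom : ∀ i, g i ∈ 𝒜 (d i)) (q : ℕ) {x : M}
    (hx : x ∈ subGen (M := M) g q) (p : ℤ) : (decompose ℳ x p : M) ∈ subGen (M := M) g q := by
  rw [subGen] at hx
  induction hx using Submodule.iSup_induction' with
  | zero => simp
  | add x y _ _ hx hy => simpa [decompose_add] using add_mem hx hy
  | mem i x hx =>
    by_cases hi : (i : ℕ) < q
    · simp only [hi, iSup_pos, LinearMap.mem_range] at hx
      obtain ⟨y, rfl⟩ := hx
      rw [LinearMap.lsmul_apply, decompose_smul_apply 𝒜 ℳ (hghom i)]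
      exact Submodule.mem_iSup_of_mem i (Submodule.mem_iSup_of_mem hi ⟨_, rfl⟩)
    · simp only [hi, not_false_eq_true, iSup_neg, Submodule.mem_bot] at hx
      simp [hx]

lemma subGen_succ (g : Fin m → A) (q : Fin m) :
    subGen (M := M) g (q + 1) =
      subGen (M := M) g q ⊔ LinearMap.range (LinearMap.lsmul A M (g q)) := by
  refine le_antisymm (iSup₂_le fun i hi => ?_) (sup_le (iSup₂_le fun i hi => ?_) ?_)
  · rcases Nat.lt_succ_iff_lt_or_eq.1 hi with h | h
    · exact le_sup_of_le_left (le_iSup₂_of_le i h le_rfl)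
    · rw [Fin.ext h]
      exact le_sup_right
  · exact le_iSup₂_of_le i (Nat.lt_succ_of_lt hi) le_rfl
  · exact le_iSup₂_of_le q (Nat.lt_succ_self _) le_rfl

lemma finrank_map_add_finrank_inf_ker {V W : Type*} [AddCommGroup V] [Module k V]
    [AddCommGroup W] [Module k W] (f : V →ₗ[k] W) (S : Submodule k V) [Module.Finite k S] :
    Module.finrank k (S.map f) + Module.finrank k (S ⊓ LinearMap.ker f : Submodule k V) =
      Module.finrank k S := by
  rw [← LinearMap.finrank_range_add_finrank_ker (f.domRestrict S), LinearMap.range_domRestrict,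
    LinearMap.ker_domRestrict, ← Submodule.map_comap_subtype,
    Submodule.finrank_map_subtype_eq]

variable [IsScalarTower k A M]

/-- The kernel of multiplication by `g q` on the degree-`(p - d q)` piece of
`M / (g_0 M + ⋯ + g_{q-1} M)`. -/
def mulKer (ℳ : ℤ → Submodule k M) (d : Fin m → ℕ) (g : Fin m → A) (q : Fin m) (p : ℤ) :
    Submodule k (M ⧸ subGen (M := M) g q) :=
  quotPiece ℳ g q (p - d q) ⊓
    LinearMap.ker ((LinearMap.lsmul A (M ⧸ subGen (M := M) g q) (g q)).restrictScalars k)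

instance (ℳ : ℤ → Submodule k M) [∀ p, Module.Finite k (ℳ p)] (g : Fin m → A) (q : ℕ) (p : ℤ) :
    Module.Finite k (quotPiece ℳ g q p) :=
  inferInstanceAs (Module.Finite k ((ℳ p).map _))

lemma finrank_quotPiece_zero (ℳ : ℤ → Submodule k M) (g : Fin m → A) (p : ℤ) :
    Module.finrank k (quotPiece ℳ g 0 p) = Module.finrank k (ℳ p) := by
  refine (Submodule.equivMapOfInjective _ ?_ (ℳ p)).finrank_eq.symm
  rw [← LinearMap.ker_eq_bot, LinearMap.ker_restrictScalars, Submodule.ker_mkQ]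
  simp [subGen]

lemma quotPiece_of_eq_bot {ℳ : ℤ → Submodule k M} (g : Fin m → A) (q : ℕ) {p : ℤ}
    (h : ℳ p = ⊥) : quotPiece ℳ g q p = ⊥ := by
  rw [quotPiece, h, Submodule.map_bot]

/-- The dimension count for `M^(q)_{p-d} → M^(q)_p → M^(q+1)_p → 0`. -/
lemma finrank_quotPiece_succ (𝒜 : ℤ → Submodule k A)
    (ℳ : ℤ → Submodule k M) [DirectSum.Decomposition ℳ] [SetLike.GradedSMul 𝒜 ℳ]
    [∀ p, Module.Finite k (ℳ p)]
    {d : Fin m → ℕ} {g : Fin m → A} (hghom : ∀ i, g i ∈ 𝒜 (d i)) (q : Fin m) (p : ℤ) :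
    Module.finrank k (quotPiece ℳ g q p) + Module.finrank k (mulKer ℳ d g q p) =
      Module.finrank k (quotPiece ℳ g (q + 1) p) +
        Module.finrank k (quotPiece ℳ g q (p - d q)) := by
  have hle : subGen (M := M) g q ≤ subGen (M := M) g (q + 1) := by
    rw [subGen_succ]
    exact le_sup_left
  set φ := (LinearMap.lsmul A (M ⧸ subGen (M := M) g q) (g q)).restrictScalars k with hφ
  set π := (Submodule.factor hle).restrictScalars k with hπ
  have h1 := finrank_map_add_finrank_inf_ker φ (quotPiece ℳ g q (p - d q))
  have h2 := finrank_map_add_finrank_inf_ker π (quotPiece ℳ g q p)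
  have h3 : (quotPiece ℳ g q p).map π = quotPiece ℳ g (q + 1) p := by
    rw [quotPiece, quotPiece, ← Submodule.map_comp]
    rfl
  have h4 : quotPiece ℳ g q p ⊓ LinearMap.ker π = (quotPiece ℳ g q (p - d q)).map φ := by
    ext y
    constructor
    · rintro ⟨⟨x, hx, rfl⟩, hy⟩
      have hx' : x ∈ subGen (M := M) g (q + 1) := by
        simpa [hπ] using hy
      rw [subGen_succ] at hx'
      obtain ⟨u, hu, v, ⟨z, rfl⟩, huv⟩ := Submodule.mem_sup.1 hx'
      refine ⟨_, ⟨(decompose ℳ z (p - d q) : M), (decompose ℳ z (p - d q)).2, rfl⟩, ?_⟩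
      have h5 : x = (decompose ℳ u p : M) + g q • (decompose ℳ z (p - d q) : M) := by
        rw [← decompose_smul_apply 𝒜 ℳ (hghom q), ← decompose_of_mem_same ℳ hx, ← huv]
        simp [decompose_add]
      change Submodule.Quotient.mk (g q • (decompose ℳ z (p - d q) : M)) = Submodule.Quotient.mk x
      rw [eq_comm, Submodule.Quotient.eq]
      nth_rewrite 1 [h5]
      rw [add_sub_cancel_right]
      exact decompose_mem_subGen 𝒜 ℳ hghom q hu p
    · rintro ⟨_, ⟨x, hx, rfl⟩, rfl⟩
      refine ⟨⟨g q • x, ?_, rfl⟩, ?_⟩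
      · have := SetLike.GradedSMul.smul_mem (hghom q) hx
        simpa using this
      · change Submodule.Quotient.mk (g q • x) = 0
        rw [Submodule.Quotient.mk_eq_zero, subGen_succ]
        exact Submodule.mem_sup_right ⟨x, rfl⟩
  rw [h3, h4] at h2
  rw [← h1, ← h2, mulKer]
  ring

lemma finrank_mulKer_eq_zero_iff (ℳ : ℤ → Submodule k M) [∀ p, Module.Finite k (ℳ p)]
    (d : Fin m → ℕ) (g : Fin m → A) (q : Fin m) (p : ℤ) :
    Module.finrank k (mulKer ℳ d g q p) = 0 ↔
      ∀ x ∈ quotPiece ℳ g (q : ℕ) (p - d q), g q • x = 0 → x = 0 := by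
  have : Module.Finite k (mulKer ℳ d g q p) :=
    Submodule.finiteDimensional_of_le inf_le_left
  rw [Submodule.finrank_eq_zero, Submodule.eq_bot_iff]
  simp [mulKer]

end Graded

/-- Let `M` be a finitely generated graded module over a graded `k`-algebra `A` (`k` a
field), and `g_1, …, g_m` nonzero homogeneous elements of positive degrees `d_i`.
Then the Hilbert series satisfy `H(M,z) ≤ H(M/(g)M, z) / ∏(1 - z^{d_i})`
coefficientwise; and the coefficients in all degrees `< n` are equal iff for each `q`
and each `p < n` multiplication by `g_q` is injective from the `(p - d_q)`-th to the
`p`-th graded piece of `M/(g_1,…,g_{q-1})M`. -/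
theorem hilbert_series_of_quotient_by_forms
    (k A M : Type) [Field k] [CommRing A] [Algebra k A]
    [AddCommGroup M] [Module k M] [Module A M] [IsScalarTower k A M]
    (𝒜 : ℤ → Submodule k A) [GradedAlgebra 𝒜] (h𝒜neg : ∀ p : ℤ, p < 0 → 𝒜 p = ⊥)
    (ℳ : ℤ → Submodule k M) [DirectSum.Decomposition ℳ] [SetLike.GradedSMul 𝒜 ℳ]
    [Module.Finite A M] [∀ p, Module.Finite k (ℳ p)]
    (m : ℕ) (d : Fin m → ℕ) (hd : ∀ i, 0 < d i)
    (g : Fin m → A) (hghom : ∀ i, g i ∈ 𝒜 (d i)) (hg0 : ∀ i, g i ≠ 0)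
    (n : ℤ) :
    -- `H(M,z) ≤ H(M^{(m)},z)/P(z)` coefficientwise
    (∀ p : ℤ, Module.finrank k (ℳ p) ≤
      ∑ᶠ j : ℤ, Module.finrank k (quotPiece ℳ g m (p - j)) * invPCoeff d j) ∧
    -- equality in degrees `< n` iff all the multiplication maps are injective there
    ((∀ p : ℤ, p < n → Module.finrank k (ℳ p) =
        ∑ᶠ j : ℤ, Module.finrank k (quotPiece ℳ g m (p - j)) * invPCoeff d j) ↔
      (∀ (q : Fin m) (p : ℤ), p < n →
        ∀ x ∈ quotPiece ℳ g (q : ℕ) (p - d q), g q • x = 0 → x = 0)) := by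
  obtain ⟨b, hb⟩ := exists_forall_lt_eq_bot 𝒜 h𝒜neg ℳ
  have hf0 : ∀ q : ℕ, ∀ p < b, Module.finrank k (quotPiece ℳ g q p) = 0 := fun q p hp => by
    rw [quotPiece_of_eq_bot g q (hb p hp), finrank_bot]
  have hK0 : ∀ q : Fin m, ∀ p < b, Module.finrank k (mulKer ℳ d g q p) = 0 := fun q p hp => by
    rw [mulKer, quotPiece_of_eq_bot g q (hb (p - d q) (by omega)), bot_inf_eq, finrank_bot]
  have hM0 : ∀ p < b, Module.finrank k (ℳ p) = 0 := fun p hp => by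
    rw [hb p hp, finrank_bot]
  let F : ℕ → PowerSeries ℤ := fun q =>
    PowerSeries.mk fun t => (Module.finrank k (quotPiece ℳ g q (b + t)) : ℤ)
  let K : Fin m → PowerSeries ℤ := fun q =>
    PowerSeries.mk fun t => (Module.finrank k (mulKer ℳ d g q (b + t)) : ℤ)
  have hrec : ∀ q : Fin m, (1 - PowerSeries.X ^ d q) * F q = F (q + 1) - K q := by
    intro q
    ext t
    have h := finrank_quotPiece_succ 𝒜 ℳ hghom q (b + t)
    rw [sub_mul, one_mul, map_sub, map_sub, PowerSeries.coeff_X_pow_mul']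
    simp only [F, K, PowerSeries.coeff_mk]
    split_ifs with hdt
    · rw [Nat.cast_sub hdt, ← add_sub_assoc]
      omega
    · rw [hf0 q (b + t - d q) (by omega)] at h
      omega
  obtain ⟨E, hE, hE1, hF⟩ := exists_eq_mul_prod_sub_sum d hd F K hrec
  have hK : ∀ q t, 0 ≤ PowerSeries.coeff t (K q) := fun q t => by simp [K]
  have hcoeff : ∀ t : ℕ, (Module.finrank k (ℳ (b + t)) : ℤ) =
      ((∑ᶠ j : ℤ, Module.finrank k (quotPiece ℳ g m (b + t - j)) * invPCoeff d j : ℕ) : ℤ) -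
        PowerSeries.coeff t (∑ q, K q * E q) := by
    intro t
    rw [finsum_mul_invPCoeff d hd (fun p => Module.finrank k (quotPiece ℳ g m p)) (hf0 m) t,
      ← map_sub, ← hF, PowerSeries.coeff_mk, finrank_quotPiece_zero]
  have hlt : ∀ p < b,
      ∑ᶠ j : ℤ, Module.finrank k (quotPiece ℳ g m (p - j)) * invPCoeff d j = 0 := fun p hp =>
    finsum_mul_invPCoeff_of_lt d (fun p => Module.finrank k (quotPiece ℳ g m p)) (hf0 m) hp
  constructor
  · intro p
    rcases lt_or_ge p b with hp | hp
    · simp [hM0 p hp]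
    · obtain ⟨t, rfl⟩ := Int.le.dest hp
      have h1 := hcoeff t
      have h2 : 0 ≤ PowerSeries.coeff t (∑ q, K q * E q) := by
        rw [map_sum]
        exact Finset.sum_nonneg fun q _ => coeff_mul_nonneg (hK q) (hE q) t
      omega
  · have key := forall_coeff_sum_mul_eq_zero_iff K E hK hE hE1 (n - b).toNat
    simp only [← finrank_mulKer_eq_zero_iff]
    constructor
    · intro h q p hp
      rcases lt_or_ge p b with hpb | hpb
      · exact hK0 q p hpb
      · obtain ⟨t, rfl⟩ := Int.le.dest hpb
        have h1 := key.1 (fun s hs => by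
          have := hcoeff s
          rw [h (b + s) (by omega)] at this
          omega) q t (by omega)
        simpa only [K, PowerSeries.coeff_mk, Nat.cast_eq_zero] using h1
    · intro h p hp
      rcases lt_or_ge p b with hpb | hpb
      · rw [hM0 p hpb, hlt p hpb]
      · obtain ⟨t, rfl⟩ := Int.le.dest hpb
        have h1 := key.2 (fun q s hs => by
          simpa only [K, PowerSeries.coeff_mk, Nat.cast_eq_zero] using h q (b + s) (by omega))
          t (by omega)
        have h2 := hcoeff t
        omega
end
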